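/- Uniform stability of the macro–micro PINN loss, general boundary data (1D, isotropic scattering): assume σ_min ≤ σ_s(x) ≤ σ_max and 0 ≤ σ_a(x) ≤ σ_max on [0,1] with 0 < σ_min ≤ σ_max. Let (ρ*, g*) ∈ C¹([0,1]) × C¹(Ω) with ⟨g*⟩ ≡ 0 solve the macro–micro system with data σ_s, σ_a, G, φ, and set f* = ρ* + ε g*. There exists a constant C > 0, depending only on σ_min and σ_max (independent of ε), such that for every ε ∈ (0,1] and every pair (ρ, g) ∈ C¹([0,1]) × C¹(Ω), with f = ρ + ε g, one has ∫₀¹∫_{−1}^{1} (f − f*)² dv dx ≤ (C/ε) · E(ρ, g), where E(ρ, g) is the macro–micro PINN loss. -/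

import Mathlib

open MeasureTheory Set Function

/-- Velocity average `⟨h⟩(x) = (1/2)∫_{-1}^{1} h(x,v) dv`. -/
noncomputable def vavg (h : ℝ → ℝ → ℝ) (x : ℝ) : ℝ := (1/2) * ∫ v in (-1:ℝ)..1, h x v

/-- `f ∈ C¹(Ω)` with `Ω = [0,1] × [−1,1]`. -/
def C1Omega (f : ℝ → ℝ → ℝ) : Prop :=
  ContDiffOn ℝ 1 (uncurry f) (Icc (0:ℝ) 1 ×ˢ Icc (-1:ℝ) 1)

/-- `f` solves the 1D RTE `ε v ∂_x f = σ_s(⟨f⟩ − f) − ε² σ_a f + ε² G` on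
`Ω = [0,1] × [−1,1]` with inflow boundary data `φ`. -/
def SolvesRTE (ε : ℝ) (σs σa G : ℝ → ℝ) (φ f : ℝ → ℝ → ℝ) : Prop :=
  (∀ x ∈ Icc (0:ℝ) 1, ∀ v ∈ Icc (-1:ℝ) 1,
    ε * v * deriv (fun y => f y v) x
      = σs x * (vavg f x - f x v) - ε ^ 2 * σa x * f x v + ε ^ 2 * G x) ∧
  (∀ v ∈ Ioc (0:ℝ) 1, f 0 v = φ 0 v) ∧
  (∀ v ∈ Ico (-1:ℝ) 0, f 1 v = φ 1 v)

/-- The pair `(ρ, g)` solves the macro–micro system: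
`⟨v ∂_x g⟩ = −σ_a ρ + G` on `[0,1]`;
`v ∂_x(ρ + ε g) − ε⟨v ∂_x g⟩ = σ_s(⟨g⟩ − g) − ε² σ_a g` on `Ω`;
`ρ(0) + ε g(0,v) = φ(0,v)` for `v ∈ (0,1]` and `ρ(1) + ε g(1,v) = φ(1,v)` for `v ∈ [−1,0)`. -/
def SolvesMM (ε : ℝ) (σs σa G : ℝ → ℝ) (φ : ℝ → ℝ → ℝ)
    (ρ : ℝ → ℝ) (g : ℝ → ℝ → ℝ) : Prop :=
  (∀ x ∈ Icc (0:ℝ) 1,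
    ((1/2) * ∫ v in (-1:ℝ)..1, v * deriv (fun y => g y v) x) = -(σa x) * ρ x + G x) ∧
  (∀ x ∈ Icc (0:ℝ) 1, ∀ v ∈ Icc (-1:ℝ) 1,
    v * deriv (fun y => ρ y + ε * g y v) x
      - ε * ((1/2) * ∫ w in (-1:ℝ)..1, w * deriv (fun y => g y w) x)
      = σs x * (vavg g x - g x v) - ε ^ 2 * σa x * g x v) ∧
  (∀ v ∈ Ioc (0:ℝ) 1, ρ 0 + ε * g 0 v = φ 0 v) ∧
  (∀ v ∈ Ico (-1:ℝ) 0, ρ 1 + ε * g 1 v = φ 1 v)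

/-- The macro–micro PINN loss
`E(ρ,g) = ‖⟨v∂_x g⟩ + σ_a ρ − G‖² + ‖⟨g⟩‖²
  + ‖v∂_x(ρ+εg) − ε⟨v∂_x g⟩ − σ_s(⟨g⟩−g) + ε²σ_a g‖² + ‖ρ+εg−φ‖²_{L²(Γ₋)}`. -/
noncomputable def Eloss (ε : ℝ) (σs σa G : ℝ → ℝ) (φ : ℝ → ℝ → ℝ)
    (ρ : ℝ → ℝ) (g : ℝ → ℝ → ℝ) : ℝ :=
  (∫ x in (0:ℝ)..1,
    (((1/2) * ∫ v in (-1:ℝ)..1, v * deriv (fun y => g y v) x)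
      + σa x * ρ x - G x) ^ 2)
  + (∫ x in (0:ℝ)..1, (vavg g x) ^ 2)
  + (∫ x in (0:ℝ)..1, ∫ v in (-1:ℝ)..1,
      (v * deriv (fun y => ρ y + ε * g y v) x
        - ε * ((1/2) * ∫ w in (-1:ℝ)..1, w * deriv (fun y => g y w) x)
        - σs x * (vavg g x - g x v) + ε ^ 2 * σa x * g x v) ^ 2)
  + (∫ v in (0:ℝ)..1, (ρ 0 + ε * g 0 v - φ 0 v) ^ 2)
  + (∫ v in (-1:ℝ)..0, (ρ 1 + ε * g 1 v - φ 1 v) ^ 2)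

/-- Cauchy–Schwarz against the constant function. -/
lemma sq_intervalIntegral_le {f : ℝ → ℝ} (hf : Continuous f) {a b : ℝ} (hab : a ≤ b) :
    (∫ x in a..b, f x) ^ 2 ≤ (b - a) * ∫ x in a..b, f x ^ 2 := by
  rcases hab.eq_or_lt with rfl | hlt
  · simp
  set c := ∫ x in a..b, f x with hc
  have h0 : 0 ≤ ∫ x in a..b, ((b - a) * f x - c) ^ 2 :=
    intervalIntegral.integral_nonneg hab fun x _ => sq_nonneg _
  have h1 : ∫ x in a..b, ((b - a) * f x - c) ^ 2
      = (b - a) ^ 2 * (∫ x in a..b, f x ^ 2) - 2 * (b - a) * c * c + (b - a) * c ^ 2 := by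
    have : ∀ x, ((b - a) * f x - c) ^ 2
        = (b - a) ^ 2 * f x ^ 2 - 2 * (b - a) * c * f x + c ^ 2 := fun x => by ring
    simp_rw [this]
    rw [intervalIntegral.integral_add (Continuous.intervalIntegrable (by fun_prop) _ _) (by simp),
      intervalIntegral.integral_sub (Continuous.intervalIntegrable (by fun_prop) _ _)
        (Continuous.intervalIntegrable (by fun_prop) _ _),
      intervalIntegral.integral_const_mul, intervalIntegral.integral_const_mul,
      intervalIntegral.integral_const, ← hc]
    simp
  rw [h1] at h0
  have h2 : 0 ≤ (b - a) * ((b - a) * (∫ x in a..b, f x ^ 2) - c ^ 2) := by linarith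
  linarith [nonneg_of_mul_nonneg_right h2 (sub_pos.2 hlt)]

lemma intervalIntegral_mono_of_continuous {f g : ℝ → ℝ} (hf : Continuous f) (hg : Continuous g)
    {a b : ℝ} (hab : a ≤ b) (h : ∀ x ∈ Icc a b, f x ≤ g x) :
    ∫ x in a..b, f x ≤ ∫ x in a..b, g x :=
  intervalIntegral.integral_mono_on hab (hf.intervalIntegrable _ _) (hg.intervalIntegrable _ _) h

/-- Fundamental theorem of calculus for velocity moments. -/
lemma integral_sub_eq_integral_deriv {K K' : ℝ → ℝ → ℝ}
    (hK : Continuous (uncurry K)) (hK' : Continuous (uncurry K'))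
    (h : ∀ x v, HasDerivAt (fun y => K y v) (K' x v) x) (a b c d : ℝ) :
    (∫ v in c..d, K b v) - ∫ v in c..d, K a v = ∫ x in a..b, ∫ v in c..d, K' x v := by
  rw [intervalIntegral_intervalIntegral_swap]
  · rw [← intervalIntegral.integral_sub]
    · congr 1 with v
      rw [intervalIntegral.integral_eq_sub_of_hasDerivAt (fun x _ => h x v)
        (Continuous.intervalIntegrable (by fun_prop) _ _)]
    · exact Continuous.intervalIntegrable (by fun_prop) _ _
    · exact Continuous.intervalIntegrable (by fun_prop) _ _
  · exact (hK'.continuousOn.integrableOn_compact (isCompact_uIcc.prod isCompact_uIcc)).mono_set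
      (Set.prod_mono uIoc_subset_uIcc uIoc_subset_uIcc)

section Velocity

variable {f : ℝ → ℝ} {m : ℝ}

lemma integral_sq_eq_fluctuation (hf : Continuous f) (hm : m = (1 / 2) * ∫ v in (-1 : ℝ)..1, f v) :
    ∫ v in (-1 : ℝ)..1, f v ^ 2 = (∫ v in (-1 : ℝ)..1, (f v - m) ^ 2) + 2 * m ^ 2 := by
  have : ∀ v, (f v - m) ^ 2 = f v ^ 2 - 2 * m * f v + m ^ 2 := fun v => by ring
  simp_rw [this]
  rw [intervalIntegral.integral_add (Continuous.intervalIntegrable (by fun_prop) _ _) (by simp),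
    intervalIntegral.integral_sub (Continuous.intervalIntegrable (by fun_prop) _ _)
      (Continuous.intervalIntegrable (by fun_prop) _ _),
    intervalIntegral.integral_const_mul, intervalIntegral.integral_const]
  have h2 : ∫ v in (-1 : ℝ)..1, f v = 2 * m := by rw [hm]; ring
  rw [h2]
  norm_num
  ring

lemma integral_mul_fluctuation (hf : Continuous f) (hm : m = (1 / 2) * ∫ v in (-1 : ℝ)..1, f v) :
    ∫ v in (-1 : ℝ)..1, f v * (f v - m) = ∫ v in (-1 : ℝ)..1, (f v - m) ^ 2 := by
  have : ∀ v, f v * (f v - m) = f v ^ 2 - m * f v := fun v => by ring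
  simp_rw [this]
  rw [intervalIntegral.integral_sub (Continuous.intervalIntegrable (by fun_prop) _ _)
      (Continuous.intervalIntegrable (by fun_prop) _ _), intervalIntegral.integral_const_mul,
    integral_sq_eq_fluctuation hf hm]
  have h2 : ∫ v in (-1 : ℝ)..1, f v = 2 * m := by rw [hm]; ring
  rw [h2]
  ring

lemma integral_mul_source_le (hf : Continuous f) {S : ℝ → ℝ} (hS : Continuous S) (m : ℝ)
    {k : ℝ} (hk : 0 < k) :
    2 * ∫ v in (-1 : ℝ)..1, f v * S v
      ≤ k * (∫ v in (-1 : ℝ)..1, (f v - m) ^ 2) + k⁻¹ * (∫ v in (-1 : ℝ)..1, S v ^ 2)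
        + 2 * m * ∫ v in (-1 : ℝ)..1, S v := by
  rw [← intervalIntegral.integral_const_mul, ← intervalIntegral.integral_const_mul,
    ← intervalIntegral.integral_const_mul, ← intervalIntegral.integral_const_mul,
    ← intervalIntegral.integral_add (Continuous.intervalIntegrable (by fun_prop) _ _)
      (Continuous.intervalIntegrable (by fun_prop) _ _),
    ← intervalIntegral.integral_add (Continuous.intervalIntegrable (by fun_prop) _ _)
      (Continuous.intervalIntegrable (by fun_prop) _ _)]
  refine intervalIntegral_mono_of_continuous (by fun_prop) (by fun_prop) (by norm_num) fun v _ => ?_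
  have h : 0 ≤ k⁻¹ * (k * (f v - m) - S v) ^ 2 := by positivity
  have h' : k⁻¹ * (k * (f v - m) - S v) ^ 2
      = k * (f v - m) ^ 2 - 2 * (f v - m) * S v + k⁻¹ * S v ^ 2 := by
    field_simp
    ring
  linarith

/-- A velocity moment with weight bounded by one is controlled by the `L²` norm. -/
lemma sq_integral_weight_mul_le (hf : Continuous f) {w : ℝ → ℝ} (hw : Continuous w)
    (hw1 : ∀ v ∈ Icc (-1 : ℝ) 1, w v ^ 2 ≤ 1) :
    (∫ v in (-1 : ℝ)..1, w v * f v) ^ 2 ≤ 2 * ∫ v in (-1 : ℝ)..1, f v ^ 2 := by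
  have h1 := sq_intervalIntegral_le (f := fun v => w v * f v) (by fun_prop)
    (show (-1 : ℝ) ≤ 1 by norm_num)
  have h2 : ∫ v in (-1 : ℝ)..1, (w v * f v) ^ 2 ≤ ∫ v in (-1 : ℝ)..1, f v ^ 2 := by
    refine intervalIntegral_mono_of_continuous (by fun_prop) (by fun_prop) (by norm_num)
      fun v hv => ?_
    rw [mul_pow]
    exact mul_le_of_le_one_left (sq_nonneg _) (hw1 v hv)
  linarith

lemma sq_flux_le (hf : Continuous f) (m : ℝ) :
    (∫ v in (-1 : ℝ)..1, v * f v) ^ 2 ≤ 2 * ∫ v in (-1 : ℝ)..1, (f v - m) ^ 2 := by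
  have h : ∫ v in (-1 : ℝ)..1, v * f v = ∫ v in (-1 : ℝ)..1, v * (f v - m) := by
    have : ∀ v, v * (f v - m) = v * f v - v * m := fun v => by ring
    simp_rw [this]
    rw [intervalIntegral.integral_sub (Continuous.intervalIntegrable (by fun_prop) _ _)
      (Continuous.intervalIntegrable (by fun_prop) _ _), intervalIntegral.integral_mul_const, integral_id]
    norm_num
  rw [h]
  exact sq_integral_weight_mul_le (f := fun v => f v - m) (by fun_prop) continuous_id
    fun v hv => by nlinarith [hv.1, hv.2]

lemma sq_mean_le (hf : Continuous f) (m : ℝ) :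
    m ^ 2 ≤ 9 / 2 * ((∫ v in (-1 : ℝ)..1, v ^ 2 * f v) ^ 2
      + 2 * ∫ v in (-1 : ℝ)..1, (f v - m) ^ 2) := by
  have h : ∫ v in (-1 : ℝ)..1, v ^ 2 * (f v - m)
      = (∫ v in (-1 : ℝ)..1, v ^ 2 * f v) - 2 / 3 * m := by
    have : ∀ v, v ^ 2 * (f v - m) = v ^ 2 * f v - v ^ 2 * m := fun v => by ring
    simp_rw [this]
    rw [intervalIntegral.integral_sub (Continuous.intervalIntegrable (by fun_prop) _ _)
      (Continuous.intervalIntegrable (by fun_prop) _ _), intervalIntegral.integral_mul_const, integral_pow]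
    norm_num
  have h1 := sq_integral_weight_mul_le (f := fun v => f v - m) (w := fun v => v ^ 2)
    (by fun_prop) (by fun_prop) fun v hv => by
      have : v ^ 2 ≤ 1 := by nlinarith [hv.1, hv.2]
      nlinarith [sq_nonneg v]
  rw [h] at h1
  nlinarith [sq_nonneg (2 * (∫ v in (-1 : ℝ)..1, v ^ 2 * f v) - 2 / 3 * m)]

end Velocity

section Transport

variable {F D S : ℝ → ℝ → ℝ} {s a q : ℝ → ℝ} {ε σmin σmax : ℝ}

lemma continuous_vavg (hF : Continuous (uncurry F)) : Continuous (vavg F) := by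
  unfold vavg
  fun_prop

/-- Squared `L²` norm of `F` on the inflow boundary. -/
noncomputable def inflowSq (F : ℝ → ℝ → ℝ) : ℝ :=
  (∫ v in (0 : ℝ)..1, F 0 v ^ 2) + ∫ v in (-1 : ℝ)..0, F 1 v ^ 2

/-- Squared `L²` norm of the velocity fluctuation `F - ⟨F⟩`. -/
noncomputable def fluctuationSq (F : ℝ → ℝ → ℝ) : ℝ :=
  ∫ x in (0 : ℝ)..1, ∫ v in (-1 : ℝ)..1, (F x v - vavg F x) ^ 2

/-- Outgoing energy flux at the left end. -/
noncomputable def outflowLeft (F : ℝ → ℝ → ℝ) : ℝ :=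
  ∫ v in (-1 : ℝ)..0, -v * F 0 v ^ 2

lemma outflowLeft_nonneg (F : ℝ → ℝ → ℝ) : 0 ≤ outflowLeft F :=
  intervalIntegral.integral_nonneg (by norm_num) fun v hv =>
    mul_nonneg (by linarith [hv.2]) (sq_nonneg _)

lemma fluctuationSq_nonneg (F : ℝ → ℝ → ℝ) : 0 ≤ fluctuationSq F :=
  intervalIntegral.integral_nonneg (by norm_num) fun _ _ =>
    intervalIntegral.integral_nonneg (by norm_num) fun _ _ => sq_nonneg _

lemma outflowLeft_sub_inflowSq_le (hF : Continuous (uncurry F)) :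
    outflowLeft F - inflowSq F
      ≤ (∫ v in (-1 : ℝ)..1, v * F 1 v ^ 2) - ∫ v in (-1 : ℝ)..1, v * F 0 v ^ 2 := by
  have hsplit : ∀ x, ∫ v in (-1 : ℝ)..1, v * F x v ^ 2
      = (∫ v in (-1 : ℝ)..0, v * F x v ^ 2) + ∫ v in (0 : ℝ)..1, v * F x v ^ 2 := fun x =>
    (intervalIntegral.integral_add_adjacent_intervals
      (Continuous.intervalIntegrable (by fun_prop) _ _)
      (Continuous.intervalIntegrable (by fun_prop) _ _)).symm
  have h1 : 0 ≤ ∫ v in (0 : ℝ)..1, v * F 1 v ^ 2 :=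
    intervalIntegral.integral_nonneg (by norm_num) fun v hv => mul_nonneg hv.1 (sq_nonneg _)
  have h2 : ∫ v in (-1 : ℝ)..0, -F 1 v ^ 2 ≤ ∫ v in (-1 : ℝ)..0, v * F 1 v ^ 2 :=
    intervalIntegral_mono_of_continuous (by fun_prop) (by fun_prop) (by norm_num) fun v hv => by
      nlinarith [hv.1, sq_nonneg (F 1 v)]
  have h3 : ∫ v in (0 : ℝ)..1, v * F 0 v ^ 2 ≤ ∫ v in (0 : ℝ)..1, F 0 v ^ 2 :=
    intervalIntegral_mono_of_continuous (by fun_prop) (by fun_prop) (by norm_num) fun v hv =>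
      mul_le_of_le_one_left (sq_nonneg _) hv.2
  rw [intervalIntegral.integral_neg] at h2
  have h4 : outflowLeft F = -∫ v in (-1 : ℝ)..0, v * F 0 v ^ 2 := by
    simp only [outflowLeft, neg_mul, intervalIntegral.integral_neg]
  rw [hsplit, hsplit, h4, inflowSq]
  linarith

/-- The second velocity moment at the left end is controlled by the boundary fluxes. -/
lemma sq_moment_zero_le (hF : Continuous (uncurry F)) :
    (∫ v in (-1 : ℝ)..1, v ^ 2 * F 0 v) ^ 2 ≤ 2 * (inflowSq F + outflowLeft F) := by
  have h1 := sq_intervalIntegral_le (f := fun v => v ^ 2 * F 0 v) (by fun_prop)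
    (show (-1 : ℝ) ≤ 1 by norm_num)
  have hsplit : ∫ v in (-1 : ℝ)..1, (v ^ 2 * F 0 v) ^ 2
      = (∫ v in (-1 : ℝ)..0, (v ^ 2 * F 0 v) ^ 2) + ∫ v in (0 : ℝ)..1, (v ^ 2 * F 0 v) ^ 2 :=
    (intervalIntegral.integral_add_adjacent_intervals
      (Continuous.intervalIntegrable (by fun_prop) _ _)
      (Continuous.intervalIntegrable (by fun_prop) _ _)).symm
  have h2 : ∫ v in (-1 : ℝ)..0, (v ^ 2 * F 0 v) ^ 2 ≤ outflowLeft F :=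
    intervalIntegral_mono_of_continuous (by fun_prop) (by fun_prop) (by norm_num) fun v hv => by
      rw [mul_pow]
      refine mul_le_mul_of_nonneg_right ?_ (sq_nonneg _)
      have : v ^ 2 ≤ -v := by nlinarith [hv.1, hv.2]
      nlinarith [hv.1, hv.2, sq_nonneg v]
  have h3 : ∫ v in (0 : ℝ)..1, (v ^ 2 * F 0 v) ^ 2 ≤ ∫ v in (0 : ℝ)..1, F 0 v ^ 2 :=
    intervalIntegral_mono_of_continuous (by fun_prop) (by fun_prop) (by norm_num) fun v hv => by
      rw [mul_pow]
      refine mul_le_of_le_one_left (sq_nonneg _) (pow_le_one₀ (sq_nonneg _) ?_)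
      exact pow_le_one₀ hv.1 hv.2
  have h4 : 0 ≤ ∫ v in (-1 : ℝ)..0, F 1 v ^ 2 :=
    intervalIntegral.integral_nonneg (by norm_num) fun _ _ => sq_nonneg _
  rw [inflowSq]
  linarith

/-- Energy estimate for the scaled transport equation
`v ∂ₓF + (s/ε)(F - ⟨F⟩) + ε a F = S` with `⟨S⟩ = ε q`. -/
lemma transport_energy_le
    (hε : 0 < ε) (hσmin : 0 < σmin)
    (hs : ∀ x, σmin ≤ s x) (ha : ∀ x, 0 ≤ a x)
    (hqc : Continuous q) (hF : Continuous (uncurry F)) (hD : Continuous (uncurry D))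
    (hS : Continuous (uncurry S)) (hFD : ∀ x v, HasDerivAt (fun y => F y v) (D x v) x)
    (heq : ∀ x v, v * D x v = S x v - s x / ε * (F x v - vavg F x) - ε * a x * F x v)
    (hq : ∀ x, ∫ v in (-1 : ℝ)..1, S x v = 2 * ε * q x) {δ : ℝ} (hδ : 0 < δ) :
    outflowLeft F + σmin / ε * fluctuationSq F
      ≤ inflowSq F + ε / σmin * (∫ x in (0 : ℝ)..1, ∫ v in (-1 : ℝ)..1, S x v ^ 2)
        + ε * δ * (∫ x in (0 : ℝ)..1, vavg F x ^ 2)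
        + 4 * ε / δ * ∫ x in (0 : ℝ)..1, q x ^ 2 := by
  have hm := continuous_vavg hF
  have hflux := integral_sub_eq_integral_deriv (K := fun x v => v * F x v ^ 2)
    (K' := fun x v => v * (2 * F x v * D x v)) (by fun_prop) (by fun_prop)
    (fun x v => by
      have := ((hFD x v).pow 2).const_mul v
      simpa using this) 0 1 (-1) 1
  have hpt : ∀ x, ∫ v in (-1 : ℝ)..1, v * (2 * F x v * D x v)
      ≤ ε / σmin * (∫ v in (-1 : ℝ)..1, S x v ^ 2) + ε * δ * vavg F x ^ 2
        + 4 * ε / δ * q x ^ 2 - σmin / ε * ∫ v in (-1 : ℝ)..1, (F x v - vavg F x) ^ 2 := by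
    intro x
    have hFx : Continuous (F x) := by fun_prop
    have hSx : Continuous (S x) := by fun_prop
    have e1 : ∀ v, v * (2 * F x v * D x v) = 2 * (F x v * S x v)
        - 2 * (s x / ε) * (F x v * (F x v - vavg F x)) - 2 * (ε * a x) * F x v ^ 2 := by
      intro v
      linear_combination 2 * F x v * heq x v
    simp_rw [e1]
    rw [intervalIntegral.integral_sub (Continuous.intervalIntegrable (by fun_prop) _ _)
        (Continuous.intervalIntegrable (by fun_prop) _ _),
      intervalIntegral.integral_sub (Continuous.intervalIntegrable (by fun_prop) _ _)
        (Continuous.intervalIntegrable (by fun_prop) _ _),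
      intervalIntegral.integral_const_mul, intervalIntegral.integral_const_mul,
      intervalIntegral.integral_const_mul, integral_mul_fluctuation hFx (m := vavg F x) rfl]
    have h1 := integral_mul_source_le hFx hSx (vavg F x) (div_pos hσmin hε)
    rw [hq x, inv_div] at h1
    have h2 : 0 ≤ ∫ v in (-1 : ℝ)..1, F x v ^ 2 :=
      intervalIntegral.integral_nonneg (by norm_num) fun _ _ => sq_nonneg _
    have h3 : 0 ≤ ∫ v in (-1 : ℝ)..1, (F x v - vavg F x) ^ 2 :=
      intervalIntegral.integral_nonneg (by norm_num) fun _ _ => sq_nonneg _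
    have h4 : 0 ≤ 2 * (ε * a x) * ∫ v in (-1 : ℝ)..1, F x v ^ 2 := by
      have := ha x
      positivity
    have h5 : σmin / ε * (∫ v in (-1 : ℝ)..1, (F x v - vavg F x) ^ 2)
        ≤ s x / ε * ∫ v in (-1 : ℝ)..1, (F x v - vavg F x) ^ 2 :=
      mul_le_mul_of_nonneg_right (div_le_div_of_nonneg_right (hs x) hε.le) h3
    have h6 : 2 * vavg F x * (2 * ε * q x) ≤ ε * δ * vavg F x ^ 2 + 4 * ε / δ * q x ^ 2 := by
      have h7 : 0 ≤ ε / δ * (δ * vavg F x - 2 * q x) ^ 2 := by positivity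
      have h8 : ε / δ * (δ * vavg F x - 2 * q x) ^ 2
          = ε * δ * vavg F x ^ 2 + 4 * ε / δ * q x ^ 2 - 2 * vavg F x * (2 * ε * q x) := by
        field_simp
        ring
      linarith
    linarith
  have hint := intervalIntegral_mono_of_continuous (by fun_prop) (by fun_prop)
    (show (0 : ℝ) ≤ 1 by norm_num) fun x _ => hpt x
  rw [intervalIntegral.integral_sub (Continuous.intervalIntegrable (by fun_prop) _ _)
      (Continuous.intervalIntegrable (by fun_prop) _ _),
    intervalIntegral.integral_add (Continuous.intervalIntegrable (by fun_prop) _ _)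
      (Continuous.intervalIntegrable (by fun_prop) _ _),
    intervalIntegral.integral_add (Continuous.intervalIntegrable (by fun_prop) _ _)
      (Continuous.intervalIntegrable (by fun_prop) _ _),
    intervalIntegral.integral_const_mul, intervalIntegral.integral_const_mul,
    intervalIntegral.integral_const_mul, intervalIntegral.integral_const_mul, ← hflux] at hint
  have := outflowLeft_sub_inflowSq_le hF
  rw [fluctuationSq]
  linarith

/-- Control of the mean `⟨F⟩` through the second velocity moment. -/
lemma integral_vavg_sq_le
    (hε : 0 < ε) (hε1 : ε ≤ 1) (hσmin : 0 < σmin)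
    (hs : ∀ x, σmin ≤ s x ∧ s x ≤ σmax) (ha : ∀ x, 0 ≤ a x ∧ a x ≤ σmax)
    (hF : Continuous (uncurry F)) (hD : Continuous (uncurry D))
    (hS : Continuous (uncurry S)) (hFD : ∀ x v, HasDerivAt (fun y => F y v) (D x v) x)
    (heq : ∀ x v, v * D x v = S x v - s x / ε * (F x v - vavg F x) - ε * a x * F x v) :
    ∫ x in (0 : ℝ)..1, vavg F x ^ 2
      ≤ 9 / 2 * (4 * (inflowSq F + outflowLeft F)
        + 8 * (∫ x in (0 : ℝ)..1, ∫ v in (-1 : ℝ)..1, S x v ^ 2)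
        + (32 * σmax ^ 2 / ε ^ 2 + 2) * fluctuationSq F) := by
  have hm := continuous_vavg hF
  set P := ∫ x in (0 : ℝ)..1, ∫ v in (-1 : ℝ)..1, S x v ^ 2 with hP
  let M : ℝ → ℝ := fun x => ∫ v in (-1 : ℝ)..1, v ^ 2 * F x v
  let M' : ℝ → ℝ := fun x => ∫ v in (-1 : ℝ)..1, v ^ 2 * D x v
  have hMc : Continuous M := by fun_prop
  have hMc' : Continuous M' := by fun_prop
  have hMsub : ∀ x, M x - M 0 = ∫ y in (0 : ℝ)..x, M' y := fun x =>
    integral_sub_eq_integral_deriv (K := fun x v => v ^ 2 * F x v)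
      (K' := fun x v => v ^ 2 * D x v) (by fun_prop) (by fun_prop)
      (fun x v => (hFD x v).const_mul _) 0 x (-1) 1
  have hM'pt : ∀ x, M' x ^ 2 ≤ 4 * (∫ v in (-1 : ℝ)..1, S x v ^ 2)
      + 16 * σmax ^ 2 / ε ^ 2 * ∫ v in (-1 : ℝ)..1, (F x v - vavg F x) ^ 2 := by
    intro x
    have hFx : Continuous (F x) := by fun_prop
    have hSx : Continuous (S x) := by fun_prop
    have e1 : M' x = (∫ v in (-1 : ℝ)..1, v * S x v)
        - (s x / ε + ε * a x) * ∫ v in (-1 : ℝ)..1, v * F x v := by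
      have e2 : ∀ v, v ^ 2 * D x v = v * S x v
          - (s x / ε + ε * a x) * (v * F x v) + v * (s x / ε * vavg F x) := by
        intro v
        linear_combination v * heq x v
      simp only [M']
      simp_rw [e2]
      rw [intervalIntegral.integral_add (Continuous.intervalIntegrable (by fun_prop) _ _)
          (Continuous.intervalIntegrable (by fun_prop) _ _),
        intervalIntegral.integral_sub (Continuous.intervalIntegrable (by fun_prop) _ _)
          (Continuous.intervalIntegrable (by fun_prop) _ _),
        intervalIntegral.integral_const_mul, intervalIntegral.integral_mul_const, integral_id]
      norm_num
    have h1 := sq_integral_weight_mul_le hSx continuous_id fun v hv => by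
      have : v ^ 2 ≤ 1 := by nlinarith [hv.1, hv.2]
      simpa using this
    simp only [id] at h1
    have h2 := sq_flux_le hFx (vavg F x)
    have hc : (s x / ε + ε * a x) ^ 2 ≤ 4 * σmax ^ 2 / ε ^ 2 := by
      have hs0 : 0 ≤ s x := hσmin.le.trans (hs x).1
      have hσ0 : 0 ≤ σmax := hs0.trans (hs x).2
      have h3 : s x / ε ≤ σmax / ε := div_le_div_of_nonneg_right (hs x).2 hε.le
      have h4 : ε * a x ≤ σmax / ε := by
        rw [le_div_iff₀ hε]
        have : ε * a x * ε ≤ 1 * σmax * 1 :=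
          mul_le_mul (mul_le_mul hε1 (ha x).2 (ha x).1 zero_le_one) hε1 hε.le (by positivity)
        linarith
      have h5 : 0 ≤ s x / ε + ε * a x := by
        have := (ha x).1
        positivity
      calc (s x / ε + ε * a x) ^ 2 ≤ (2 * (σmax / ε)) ^ 2 :=
            pow_le_pow_left₀ h5 (by linarith) 2
        _ = 4 * σmax ^ 2 / ε ^ 2 := by ring
    have h6 := mul_le_mul hc h2 (sq_nonneg _) (by positivity)
    rw [e1]
    set A := ∫ v in (-1 : ℝ)..1, v * S x v
    set J := ∫ v in (-1 : ℝ)..1, v * F x v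
    have h7 : (A - (s x / ε + ε * a x) * J) ^ 2
        ≤ 2 * A ^ 2 + 2 * ((s x / ε + ε * a x) ^ 2 * J ^ 2) := by
      nlinarith [sq_nonneg (A + (s x / ε + ε * a x) * J)]
    have h8 : 2 * (4 * σmax ^ 2 / ε ^ 2 * (2 * ∫ v in (-1 : ℝ)..1, (F x v - vavg F x) ^ 2))
        = 16 * σmax ^ 2 / ε ^ 2 * ∫ v in (-1 : ℝ)..1, (F x v - vavg F x) ^ 2 := by ring
    linarith
  have hM'int : ∫ x in (0 : ℝ)..1, M' x ^ 2
      ≤ 4 * P + 16 * σmax ^ 2 / ε ^ 2 * fluctuationSq F := by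
    have hint := intervalIntegral_mono_of_continuous (by fun_prop) (by fun_prop)
      (show (0 : ℝ) ≤ 1 by norm_num) fun x _ => hM'pt x
    rwa [intervalIntegral.integral_add (Continuous.intervalIntegrable (by fun_prop) _ _)
      (Continuous.intervalIntegrable (by fun_prop) _ _),
      intervalIntegral.integral_const_mul, intervalIntegral.integral_const_mul] at hint
  have hM0 : M 0 ^ 2 ≤ 2 * (inflowSq F + outflowLeft F) := sq_moment_zero_le hF
  have hMpt : ∀ x ∈ Icc (0 : ℝ) 1, M x ^ 2
      ≤ 4 * (inflowSq F + outflowLeft F) + 2 * ∫ y in (0 : ℝ)..1, M' y ^ 2 := by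
    intro x hx
    have h1 := sq_intervalIntegral_le hMc' hx.1
    have h2 : ∫ y in (0 : ℝ)..x, M' y ^ 2 ≤ ∫ y in (0 : ℝ)..1, M' y ^ 2 :=
      intervalIntegral.integral_mono_interval le_rfl hx.1 hx.2
        (Filter.Eventually.of_forall fun _ => sq_nonneg _)
        (Continuous.intervalIntegrable (by fun_prop) _ _)
    have h3 : 0 ≤ ∫ y in (0 : ℝ)..x, M' y ^ 2 :=
      intervalIntegral.integral_nonneg hx.1 fun _ _ => sq_nonneg _
    have h4 : (x - 0) * ∫ y in (0 : ℝ)..x, M' y ^ 2 ≤ ∫ y in (0 : ℝ)..x, M' y ^ 2 :=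
      mul_le_of_le_one_left h3 (by linarith [hx.2])
    rw [← hMsub] at h1
    nlinarith [sq_nonneg (M x - 2 * M 0)]
  have hpt : ∀ x ∈ Icc (0 : ℝ) 1, vavg F x ^ 2
      ≤ 9 / 2 * (4 * (inflowSq F + outflowLeft F) + 2 * ∫ y in (0 : ℝ)..1, M' y ^ 2)
        + 9 * ∫ v in (-1 : ℝ)..1, (F x v - vavg F x) ^ 2 := by
    intro x hx
    have h1 := sq_mean_le (f := F x) (by fun_prop) (vavg F x)
    have h2 := hMpt x hx
    simp only [M] at h2
    linarith
  have hint := intervalIntegral_mono_of_continuous (by fun_prop) (by fun_prop)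
    (show (0 : ℝ) ≤ 1 by norm_num) hpt
  rw [intervalIntegral.integral_add (Continuous.intervalIntegrable (by fun_prop) _ _)
    (Continuous.intervalIntegrable (by fun_prop) _ _), intervalIntegral.integral_const,
    intervalIntegral.integral_const_mul, sub_zero, one_smul] at hint
  have h9 : (32 * σmax ^ 2 / ε ^ 2 + 2) * fluctuationSq F
      = 2 * (16 * σmax ^ 2 / ε ^ 2 * fluctuationSq F) + 2 * fluctuationSq F := by ring
  rw [← fluctuationSq] at hint
  linarith

variable (σmin σmax) in
/-- `L²` stability of the scaled transport equation, with a constant independent of `ε`. -/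
lemma transport_stability (hσmin : 0 < σmin) :
    ∃ C > 0, ∀ ε ∈ Ioc (0 : ℝ) 1, ∀ s a q : ℝ → ℝ, ∀ F D S : ℝ → ℝ → ℝ,
      (∀ x, σmin ≤ s x ∧ s x ≤ σmax) → (∀ x, 0 ≤ a x ∧ a x ≤ σmax) →
      Continuous q → Continuous (uncurry F) → Continuous (uncurry D) → Continuous (uncurry S) →
      (∀ x v, HasDerivAt (fun y => F y v) (D x v) x) →
      (∀ x v, v * D x v = S x v - s x / ε * (F x v - vavg F x) - ε * a x * F x v) →
      (∀ x, ∫ v in (-1 : ℝ)..1, S x v = 2 * ε * q x) →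
      ε * (∫ x in (0 : ℝ)..1, ∫ v in (-1 : ℝ)..1, F x v ^ 2)
        ≤ C * (inflowSq F + (∫ x in (0 : ℝ)..1, ∫ v in (-1 : ℝ)..1, S x v ^ 2)
          + ∫ x in (0 : ℝ)..1, q x ^ 2) := by
  set L : ℝ := 4 + (32 * σmax ^ 2 + 2) / σmin with hL
  have hL0 : 0 < L := by positivity
  set δ : ℝ := 1 / (9 * L) with hδ
  have hδ0 : 0 < δ := by positivity
  set κ : ℝ := 1 + 1 / σmin + 4 / δ with hκ
  have hκ0 : 0 < κ := by positivity
  refine ⟨κ / σmin + (δ / σmin + 2) * (108 + 9 * L * κ), by positivity, ?_⟩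
  rintro ε ⟨hε, hε1⟩ s a q F D S hs ha hqc hF hD hS hFD heq hq
  have hm := continuous_vavg hF
  have henergy := transport_energy_le hε hσmin (fun x => (hs x).1) (fun x => (ha x).1) hqc
    hF hD hS hFD heq hq hδ0
  have hmean := integral_vavg_sq_le hε hε1 hσmin hs ha hF hD hS hFD heq
  have hsplit : ∫ x in (0 : ℝ)..1, ∫ v in (-1 : ℝ)..1, F x v ^ 2
      = fluctuationSq F + 2 * ∫ x in (0 : ℝ)..1, vavg F x ^ 2 := by
    have h1 : ∀ x, ∫ v in (-1 : ℝ)..1, F x v ^ 2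
        = (∫ v in (-1 : ℝ)..1, (F x v - vavg F x) ^ 2) + 2 * vavg F x ^ 2 := fun x =>
      integral_sq_eq_fluctuation (by fun_prop) rfl
    simp_rw [h1]
    rw [intervalIntegral.integral_add (Continuous.intervalIntegrable (by fun_prop) _ _)
      (Continuous.intervalIntegrable (by fun_prop) _ _), intervalIntegral.integral_const_mul]
    rfl
  rw [hsplit]
  have hO := outflowLeft_nonneg F
  have hH := fluctuationSq_nonneg F
  have hB : 0 ≤ inflowSq F := add_nonneg
    (intervalIntegral.integral_nonneg (by norm_num) fun _ _ => sq_nonneg _)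
    (intervalIntegral.integral_nonneg (by norm_num) fun _ _ => sq_nonneg _)
  have hP : 0 ≤ ∫ x in (0 : ℝ)..1, ∫ v in (-1 : ℝ)..1, S x v ^ 2 :=
    intervalIntegral.integral_nonneg (by norm_num) fun _ _ =>
      intervalIntegral.integral_nonneg (by norm_num) fun _ _ => sq_nonneg _
  have hQ : 0 ≤ ∫ x in (0 : ℝ)..1, q x ^ 2 :=
    intervalIntegral.integral_nonneg (by norm_num) fun _ _ => sq_nonneg _
  generalize (∫ x in (0 : ℝ)..1, ∫ v in (-1 : ℝ)..1, S x v ^ 2) = P at *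
  generalize (∫ x in (0 : ℝ)..1, q x ^ 2) = Q at *
  generalize (∫ x in (0 : ℝ)..1, vavg F x ^ 2) = X at *
  generalize inflowSq F = B at *
  generalize fluctuationSq F = H at *
  generalize outflowLeft F = O at *
  set E := B + P + Q with hE
  have hE0 : 0 ≤ E := by positivity
  set T := κ * E + δ * (ε * X) with hT
  have hTle : O + σmin / ε * H ≤ T := by
    have h1 : ε / σmin * P ≤ 1 / σmin * P :=
      mul_le_mul_of_nonneg_right (div_le_div_of_nonneg_right hε1 hσmin.le) hP
    have h2 : 4 * ε / δ * Q ≤ 4 / δ * Q :=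
      mul_le_mul_of_nonneg_right (div_le_div_of_nonneg_right (by linarith) hδ0.le) hQ
    have h3 : κ * E = B + 1 / σmin * P + 4 / δ * Q
        + (P + Q + 1 / σmin * (B + Q) + 4 / δ * (B + P)) := by
      rw [hκ, hE]; ring
    have h4 : 0 ≤ P + Q + 1 / σmin * (B + Q) + 4 / δ * (B + P) := by positivity
    linarith
  have hHε : 0 ≤ σmin / ε * H := by positivity
  have hOT : O ≤ T := by linarith
  have hHT : H / ε ≤ T / σmin := by
    rw [le_div_iff₀ hσmin]
    calc H / ε * σmin = σmin / ε * H := by ring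
      _ ≤ T := by linarith
  have hT0 : 0 ≤ T := by linarith
  have hX : ε * X ≤ (108 + 9 * L * κ) * E := by
    have h1 : ε * ((32 * σmax ^ 2 / ε ^ 2 + 2) * H) ≤ (32 * σmax ^ 2 + 2) / σmin * T := by
      calc ε * ((32 * σmax ^ 2 / ε ^ 2 + 2) * H)
          = (32 * σmax ^ 2 + 2 * ε ^ 2) * (H / ε) := by field_simp
        _ ≤ (32 * σmax ^ 2 + 2) * (T / σmin) :=
            mul_le_mul (by nlinarith) hHT (by positivity) (by positivity)
        _ = (32 * σmax ^ 2 + 2) / σmin * T := by ring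
    have h2 : ε * (B + O) ≤ B + T := by nlinarith
    have h3 : ε * P ≤ P := mul_le_of_le_one_left hP hε1
    have h4 := mul_le_mul_of_nonneg_left hmean hε.le
    have h5 : ε * X ≤ 54 * E + 9 / 2 * (L * T) := by
      have h6 : L * T = 4 * T + (32 * σmax ^ 2 + 2) / σmin * T := by rw [hL]; ring
      have h7 : B + P ≤ E := by linarith
      linarith
    have h8 : 9 / 2 * (L * T) = 9 / 2 * L * κ * E + 1 / 2 * (ε * X) := by
      rw [hT, hδ]
      field_simp
    linarith
  have hHfin : ε * H ≤ T / σmin := by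
    refine le_trans ?_ hHT
    rw [le_div_iff₀ hε]
    nlinarith [mul_le_one₀ hε1 hε.le hε1]
  have hTfin : T / σmin ≤ κ / σmin * E + δ / σmin * ((108 + 9 * L * κ) * E) := by
    have h1 : T / σmin = κ / σmin * E + δ / σmin * (ε * X) := by rw [hT]; ring
    rw [h1]
    gcongr
  linarith

end Transport

section MacroMicro

variable (σmin σmax : ℝ)

/-- Stability of the macro–micro residuals for globally defined pairs. -/
lemma macro_micro_stability (hσmin : 0 < σmin) :
    ∃ C > 0, ∀ ε ∈ Ioc (0 : ℝ) 1, ∀ s a r r' : ℝ → ℝ, ∀ h h' : ℝ → ℝ → ℝ,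
      (∀ x, σmin ≤ s x ∧ s x ≤ σmax) → (∀ x, 0 ≤ a x ∧ a x ≤ σmax) →
      Continuous s → Continuous a → Continuous r → Continuous r' →
      Continuous (uncurry h) → Continuous (uncurry h') →
      (∀ x, HasDerivAt r (r' x) x) →
      (∀ x v, HasDerivAt (fun y => h y v) (h' x v) x) →
      ε * (∫ x in (0 : ℝ)..1, ∫ v in (-1 : ℝ)..1, (r x + ε * h x v) ^ 2)
        ≤ C * ((∫ x in (0 : ℝ)..1, ((1 / 2) * (∫ v in (-1 : ℝ)..1, v * h' x v) + a x * r x) ^ 2)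
          + (∫ x in (0 : ℝ)..1, vavg h x ^ 2)
          + (∫ x in (0 : ℝ)..1, ∫ v in (-1 : ℝ)..1,
              (v * (r' x + ε * h' x v) - ε * ((1 / 2) * ∫ w in (-1 : ℝ)..1, w * h' x w)
                - s x * (vavg h x - h x v) + ε ^ 2 * a x * h x v) ^ 2)
          + inflowSq fun x v => r x + ε * h x v) := by
  obtain ⟨C, hC, hstab⟩ := transport_stability σmin σmax hσmin
  refine ⟨C * (6 + 2 * σmax ^ 2), by positivity, ?_⟩
  intro ε hε s a r r' h h' hs ha hsc hac hrc hrc' hhc hhc' hr hh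
  have hm := continuous_vavg hhc
  let J : ℝ → ℝ := fun x => (1 / 2) * ∫ v in (-1 : ℝ)..1, v * h' x v
  have hJc : Continuous J := by fun_prop
  let R₁ : ℝ → ℝ := fun x => J x + a x * r x
  let R₃ : ℝ → ℝ → ℝ := fun x v => v * (r' x + ε * h' x v) - ε * J x
    - s x * (vavg h x - h x v) + ε ^ 2 * a x * h x v
  have hR₁ : Continuous R₁ := by fun_prop
  have hR₃ : Continuous (uncurry R₃) := by fun_prop
  have hmean : ∀ x, vavg (fun x v => r x + ε * h x v) x = r x + ε * vavg h x := fun x => by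
    simp only [vavg]
    rw [intervalIntegral.integral_add (by simp) (Continuous.intervalIntegrable (by fun_prop) _ _),
      intervalIntegral.integral_const_mul, intervalIntegral.integral_const, smul_eq_mul]
    ring
  have hmain := hstab ε hε s a (fun x => R₁ x + ε * (a x * vavg h x))
    (fun x v => r x + ε * h x v) (fun x v => r' x + ε * h' x v) (fun x v => R₃ x v + ε * R₁ x)
    hs ha (by fun_prop) (by fun_prop) (by fun_prop) (by fun_prop)
    (fun x v => (hr x).add ((hh x v).const_mul ε))
    (fun x v => by
      have := hε.1.ne'
      rw [hmean]
      simp only [R₃, R₁]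
      field_simp
      ring)
    (fun x => by
      have e1 : ∀ v, R₃ x v + ε * R₁ x = v * r' x + ε * (v * h' x v)
          + (s x + ε ^ 2 * a x) * h x v + (ε * R₁ x - ε * J x - s x * vavg h x) := fun v => by
        simp only [R₃]
        ring
      have e2 : ∫ v in (-1 : ℝ)..1, v * h' x v = 2 * J x := by simp only [J]; ring
      have e3 : ∫ v in (-1 : ℝ)..1, h x v = 2 * vavg h x := by simp only [vavg]; ring
      simp_rw [e1]
      rw [intervalIntegral.integral_add (Continuous.intervalIntegrable (by fun_prop) _ _) (by simp),
        intervalIntegral.integral_add (Continuous.intervalIntegrable (by fun_prop) _ _)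
          (Continuous.intervalIntegrable (by fun_prop) _ _),
        intervalIntegral.integral_add (Continuous.intervalIntegrable (by fun_prop) _ _)
          (Continuous.intervalIntegrable (by fun_prop) _ _),
        intervalIntegral.integral_mul_const, intervalIntegral.integral_const_mul,
        intervalIntegral.integral_const_mul, intervalIntegral.integral_const, integral_id, e2, e3,
        smul_eq_mul]
      ring)
  change _ ≤ C * (6 + 2 * σmax ^ 2) * ((∫ x in (0 : ℝ)..1, R₁ x ^ 2)
    + (∫ x in (0 : ℝ)..1, vavg h x ^ 2)
    + (∫ x in (0 : ℝ)..1, ∫ v in (-1 : ℝ)..1, R₃ x v ^ 2) + _)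
  have hε2 : ε ^ 2 ≤ 1 := pow_le_one₀ hε.1.le hε.2
  have hP : ∫ x in (0 : ℝ)..1, ∫ v in (-1 : ℝ)..1, (R₃ x v + ε * R₁ x) ^ 2
      ≤ 2 * (∫ x in (0 : ℝ)..1, ∫ v in (-1 : ℝ)..1, R₃ x v ^ 2)
        + 4 * ∫ x in (0 : ℝ)..1, R₁ x ^ 2 := by
    rw [← intervalIntegral.integral_const_mul, ← intervalIntegral.integral_const_mul,
      ← intervalIntegral.integral_add (Continuous.intervalIntegrable (by fun_prop) _ _)
        (Continuous.intervalIntegrable (by fun_prop) _ _)]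
    refine intervalIntegral_mono_of_continuous (by fun_prop) (by fun_prop) (by norm_num)
      fun x _ => ?_
    have h1 : ∫ v in (-1 : ℝ)..1, (R₃ x v + ε * R₁ x) ^ 2
        ≤ ∫ v in (-1 : ℝ)..1, (2 * R₃ x v ^ 2 + 2 * R₁ x ^ 2) := by
      refine intervalIntegral_mono_of_continuous (by fun_prop) (by fun_prop) (by norm_num)
        fun v _ => ?_
      nlinarith [sq_nonneg (R₃ x v - ε * R₁ x), mul_le_of_le_one_left (sq_nonneg (R₁ x)) hε2]
    rw [intervalIntegral.integral_add (Continuous.intervalIntegrable (by fun_prop) _ _)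
      (by simp), intervalIntegral.integral_const_mul, intervalIntegral.integral_const,
      smul_eq_mul] at h1
    linarith
  have hQ : ∫ x in (0 : ℝ)..1, (R₁ x + ε * (a x * vavg h x)) ^ 2
      ≤ 2 * (∫ x in (0 : ℝ)..1, R₁ x ^ 2)
        + 2 * σmax ^ 2 * ∫ x in (0 : ℝ)..1, vavg h x ^ 2 := by
    rw [← intervalIntegral.integral_const_mul, ← intervalIntegral.integral_const_mul,
      ← intervalIntegral.integral_add (Continuous.intervalIntegrable (by fun_prop) _ _)
        (Continuous.intervalIntegrable (by fun_prop) _ _)]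
    refine intervalIntegral_mono_of_continuous (by fun_prop) (by fun_prop) (by norm_num)
      fun x _ => ?_
    have h1 : a x ^ 2 ≤ σmax ^ 2 := pow_le_pow_left₀ (ha x).1 (ha x).2 2
    have h2 : ε ^ 2 * (a x ^ 2 * vavg h x ^ 2) ≤ σmax ^ 2 * vavg h x ^ 2 :=
      (mul_le_of_le_one_left (by positivity) hε2).trans
        (mul_le_mul_of_nonneg_right h1 (sq_nonneg _))
    nlinarith [sq_nonneg (R₁ x - ε * (a x * vavg h x))]
  have h1 : 0 ≤ ∫ x in (0 : ℝ)..1, R₁ x ^ 2 :=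
    intervalIntegral.integral_nonneg (by norm_num) fun _ _ => sq_nonneg _
  have h2 : 0 ≤ ∫ x in (0 : ℝ)..1, vavg h x ^ 2 :=
    intervalIntegral.integral_nonneg (by norm_num) fun _ _ => sq_nonneg _
  have h3 : 0 ≤ ∫ x in (0 : ℝ)..1, ∫ v in (-1 : ℝ)..1, R₃ x v ^ 2 :=
    intervalIntegral.integral_nonneg (by norm_num) fun _ _ =>
      intervalIntegral.integral_nonneg (by norm_num) fun _ _ => sq_nonneg _
  have h4 : 0 ≤ inflowSq fun x v => r x + ε * h x v := add_nonneg
    (intervalIntegral.integral_nonneg (by norm_num) fun _ _ => sq_nonneg _)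
    (intervalIntegral.integral_nonneg (by norm_num) fun _ _ => sq_nonneg _)
  refine hmain.trans ?_
  rw [mul_assoc]
  refine mul_le_mul_of_nonneg_left ?_ hC.le
  nlinarith [mul_nonneg (sq_nonneg σmax) h1, mul_nonneg (sq_nonneg σmax) h3,
    mul_nonneg (sq_nonneg σmax) h4]

end MacroMicro

section Extension

/-- A `C¹` function on `Ω` extends to the plane, with jointly continuous `x`-derivative. -/
lemma C1Omega.exists_extension {f : ℝ → ℝ → ℝ} (hf : C1Omega f) :
    ∃ H H' : ℝ → ℝ → ℝ, Continuous (uncurry H) ∧ Continuous (uncurry H') ∧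
      (∀ x v, HasDerivAt (fun y => H y v) (H' x v) x) ∧
      ∀ x ∈ Icc (0 : ℝ) 1, ∀ v ∈ Icc (-1 : ℝ) 1, f x v = H x v := by
  set Ω : Set (ℝ × ℝ) := Icc (0 : ℝ) 1 ×ˢ Icc (-1 : ℝ) 1 with hΩ
  have hcont : ContinuousOn (uncurry f) Ω := hf.continuousOn
  have hd : ContinuousOn (fun p => fderivWithin ℝ (uncurry f) Ω p (1, 0)) Ω :=
    (hf.continuousOn_fderivWithin ((uniqueDiffOn_Icc zero_lt_one).prod
      (uniqueDiffOn_Icc (by norm_num))) le_rfl).clm_apply continuousOn_const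
  let cx : ℝ → ℝ := fun x => max 0 (min 1 x)
  let cv : ℝ → ℝ := fun v => max (-1) (min 1 v)
  have hcx : ∀ x, cx x ∈ Icc (0 : ℝ) 1 := fun x =>
    ⟨le_max_left _ _, max_le zero_le_one (min_le_left _ _)⟩
  have hcv : ∀ v, cv v ∈ Icc (-1 : ℝ) 1 := fun v =>
    ⟨le_max_left _ _, max_le (by norm_num) (min_le_left _ _)⟩
  have hcxc : Continuous cx := by fun_prop
  have hcvc : Continuous cv := by fun_prop
  let H' : ℝ → ℝ → ℝ := fun x v => fderivWithin ℝ (uncurry f) Ω (cx x, cv v) (1, 0)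
  have hH' : Continuous (uncurry H') :=
    hd.comp_continuous (f := fun p : ℝ × ℝ => (cx p.1, cv p.2)) (by fun_prop)
      fun p => ⟨hcx _, hcv _⟩
  have h0 : Continuous fun v => f 0 (cv v) :=
    hcont.comp_continuous (f := fun v => ((0 : ℝ), cv v)) (by fun_prop)
      fun v => ⟨⟨le_rfl, zero_le_one⟩, hcv v⟩
  refine ⟨fun x v => f 0 (cv v) + ∫ t in (0 : ℝ)..x, H' t v, H', ?_, hH', fun x v => ?_,
    fun x hx v hv => ?_⟩
  · have : Continuous fun p : ℝ × ℝ => ∫ t in (0 : ℝ)..p.1, H' t p.2 :=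
      intervalIntegral.continuous_parametric_intervalIntegral_of_continuous
        (f := fun (p : ℝ × ℝ) t => H' t p.2) (by fun_prop) continuous_fst
    exact (h0.comp continuous_snd).add this
  · have hc : Continuous fun t => H' t v := by fun_prop
    exact (hc.integral_hasStrictDerivAt 0 x).hasDerivAt.const_add _
  · have hcv_eq : cv v = v := by simp [cv, hv.1, hv.2]
    have hslice : ContinuousOn (fun y => f y v) (Icc 0 x) :=
      hcont.comp (f := fun y => (y, v)) (by fun_prop) fun y hy => ⟨⟨hy.1, hy.2.trans hx.2⟩, hv⟩
    have hderiv : ∀ y ∈ Ioo 0 x, HasDerivAt (fun y => f y v) (H' y v) y := fun y hy => by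
      have hy1 : y < 1 := hy.2.trans_le hx.2
      have hyI : y ∈ Icc (0 : ℝ) 1 := ⟨hy.1.le, hy1.le⟩
      have hcx_eq : cx y = y := by simp [cx, hyI.1, hyI.2]
      have h1 : HasFDerivWithinAt (uncurry f) (fderivWithin ℝ (uncurry f) Ω (y, v)) Ω (y, v) :=
        ((hf.differentiableOn one_ne_zero) _ ⟨hyI, hv⟩).hasFDerivWithinAt
      have h2 : HasDerivWithinAt (fun t : ℝ => (t, v)) ((1 : ℝ), (0 : ℝ)) (Icc 0 1) y :=
        ((hasDerivAt_id y).prodMk (hasDerivAt_const y v)).hasDerivWithinAt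
      have hmaps : MapsTo (fun t : ℝ => (t, v)) (Icc 0 1) Ω := fun t ht => ⟨ht, hv⟩
      have h3 := h1.comp_hasDerivWithinAt y h2 hmaps
      simp only [H', hcx_eq, hcv_eq]
      exact h3.hasDerivAt (Icc_mem_nhds hy.1 hy1)
    have := intervalIntegral.integral_eq_sub_of_hasDerivAt_of_le hx.1 hslice hderiv
      (Continuous.intervalIntegrable (by fun_prop) _ _)
    simp only [this, hcv_eq]
    ring

lemma exists_extension_of_contDiffOn {f : ℝ → ℝ} (hf : ContDiffOn ℝ 1 f (Icc 0 1)) :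
    ∃ R R' : ℝ → ℝ, Continuous R ∧ Continuous R' ∧ (∀ x, HasDerivAt R (R' x) x) ∧
      ∀ x ∈ Icc (0 : ℝ) 1, f x = R x := by
  have hf' : C1Omega fun x _ => f x :=
    hf.comp (g := f) (f := Prod.fst) contDiff_fst.contDiffOn fun p hp => hp.1
  obtain ⟨H, H', hH, hH', hd, heq⟩ := hf'.exists_extension
  exact ⟨fun x => H x 0, fun x => H' x 0, by fun_prop, by fun_prop, fun x => hd x 0,
    fun x hx => heq x hx 0 (by norm_num)⟩

lemma exists_continuous_extension {f : ℝ → ℝ} (hf : ContinuousOn f (Icc 0 1)) {l u : ℝ}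
    (hb : ∀ x ∈ Icc (0 : ℝ) 1, l ≤ f x ∧ f x ≤ u) :
    ∃ F : ℝ → ℝ, Continuous F ∧ (∀ x, l ≤ F x ∧ F x ≤ u) ∧ ∀ x ∈ Icc (0 : ℝ) 1, f x = F x := by
  have hc : ∀ x : ℝ, max 0 (min 1 x) ∈ Icc (0 : ℝ) 1 := fun x =>
    ⟨le_max_left _ _, max_le zero_le_one (min_le_left _ _)⟩
  refine ⟨fun x => f (max 0 (min 1 x)), hf.comp_continuous (by fun_prop) hc,
    fun x => hb _ (hc x), fun x hx => ?_⟩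
  simp [hx.1, hx.2]

end Extension

/-- Uniform stability of the macro–micro PINN loss, general boundary data: there is a
constant `C > 0` depending only on `σ_min, σ_max` such that for every `ε ∈ (0,1]`, every
exact macro–micro solution `(ρ*, g*)` and every `C¹` pair `(ρ, g)`, with `f = ρ + εg`
and `f* = ρ* + εg*`, one has `‖f − f*‖²_{L²(Ω)} ≤ (C/ε) E(ρ,g)`. -/
theorem loss_stability_general_bc (σmin σmax : ℝ) (hσmin : 0 < σmin) (hσ : σmin ≤ σmax) :
    ∃ C > 0, ∀ σs σa G : ℝ → ℝ, ∀ φ : ℝ → ℝ → ℝ,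
      (∀ x ∈ Icc (0:ℝ) 1, σmin ≤ σs x ∧ σs x ≤ σmax) →
      (∀ x ∈ Icc (0:ℝ) 1, 0 ≤ σa x ∧ σa x ≤ σmax) →
      ContinuousOn σs (Icc 0 1) → ContinuousOn σa (Icc 0 1) →
      ContinuousOn G (Icc 0 1) →
      ∀ ε ∈ Ioc (0:ℝ) 1, ∀ ρs : ℝ → ℝ, ∀ gs : ℝ → ℝ → ℝ,
        ContDiffOn ℝ 1 ρs (Icc 0 1) → C1Omega gs →
        (∀ x ∈ Icc (0:ℝ) 1, vavg gs x = 0) →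
        SolvesMM ε σs σa G φ ρs gs →
        ∀ ρ : ℝ → ℝ, ∀ g : ℝ → ℝ → ℝ,
          ContDiffOn ℝ 1 ρ (Icc 0 1) → C1Omega g →
          (∫ x in (0:ℝ)..1, ∫ v in (-1:ℝ)..1,
              ((ρ x + ε * g x v) - (ρs x + ε * gs x v)) ^ 2)
            ≤ (C / ε) * Eloss ε σs σa G φ ρ g := by
  obtain ⟨C, hC, hstab⟩ := macro_micro_stability σmin σmax hσmin
  refine ⟨C, hC, ?_⟩
  intro σs σa G φ hσs hσa hσsc hσac _ ε hε ρs gs hρs hgs havg hsol ρ g hρ hg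
  obtain ⟨s, hsc, hs, hs_eq⟩ := exists_continuous_extension hσsc hσs
  obtain ⟨a, hac, ha, ha_eq⟩ := exists_continuous_extension hσac hσa
  obtain ⟨r, r', hr, hr', hrd, hr_eq⟩ := exists_extension_of_contDiffOn hρ
  obtain ⟨rs, rs', hrs, hrs', hrsd, hrs_eq⟩ := exists_extension_of_contDiffOn hρs
  obtain ⟨h, h', hh, hh', hhd, hh_eq⟩ := hg.exists_extension
  obtain ⟨k, k', hhs, hhs', hhsd, hgs_eq⟩ := hgs.exists_extension
  obtain ⟨hsol₁, hsol₂, hsol₃, hsol₄⟩ := hsol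
  have hmain := hstab ε hε s a (fun x => r x - rs x) (fun x => r' x - rs' x)
    (fun x v => h x v - k x v) (fun x v => h' x v - k' x v) hs ha hsc hac
    (by fun_prop) (by fun_prop) (by fun_prop) (by fun_prop)
    (fun x => (hrd x).sub (hrsd x)) (fun x v => (hhd x v).sub (hhsd x v))
  have deriv_eq : ∀ {p P p' : ℝ → ℝ}, (∀ x, HasDerivAt P (p' x) x) →
      (∀ x ∈ Icc (0 : ℝ) 1, p x = P x) → ∀ x ∈ Ioo (0 : ℝ) 1, HasDerivAt p (p' x) x :=
    fun hP hpP x hx => (hP x).congr_of_eventuallyEq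
      (Filter.eventually_of_mem (Icc_mem_nhds hx.1 hx.2) hpP)
  have hρd := deriv_eq hrd hr_eq
  have hρsd := deriv_eq hrsd hrs_eq
  have hgd : ∀ v ∈ Icc (-1 : ℝ) 1, ∀ x ∈ Ioo (0 : ℝ) 1,
      HasDerivAt (fun y => g y v) (h' x v) x := fun v hv =>
    deriv_eq (fun x => hhd x v) fun x hx => hh_eq x hx v hv
  have hgsd : ∀ v ∈ Icc (-1 : ℝ) 1, ∀ x ∈ Ioo (0 : ℝ) 1,
      HasDerivAt (fun y => gs y v) (k' x v) x := fun v hv =>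
    deriv_eq (fun x => hhsd x v) fun x hx => hgs_eq x hx v hv
  have huIcc : uIcc (-1 : ℝ) 1 = Icc (-1) 1 := uIcc_of_le (by norm_num)
  have hJ : ∀ x ∈ Ioo (0 : ℝ) 1, ∫ v in (-1 : ℝ)..1, v * deriv (fun y => g y v) x
      = ∫ v in (-1 : ℝ)..1, v * h' x v := fun x hx =>
    intervalIntegral.integral_congr fun v hv => by
      simp only [(hgd v (huIcc ▸ hv) x hx).deriv]
  have hJs : ∀ x ∈ Ioo (0 : ℝ) 1, ∫ v in (-1 : ℝ)..1, v * deriv (fun y => gs y v) x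
      = ∫ v in (-1 : ℝ)..1, v * k' x v := fun x hx =>
    intervalIntegral.integral_congr fun v hv => by
      simp only [(hgsd v (huIcc ▸ hv) x hx).deriv]
  have hJsub : ∀ x, ∫ v in (-1 : ℝ)..1, v * (h' x v - k' x v)
      = (∫ v in (-1 : ℝ)..1, v * h' x v) - ∫ v in (-1 : ℝ)..1, v * k' x v := fun x => by
    simp_rw [mul_sub]
    exact intervalIntegral.integral_sub (Continuous.intervalIntegrable (by fun_prop) _ _)
      (Continuous.intervalIntegrable (by fun_prop) _ _)
  have hvavg : ∀ x ∈ Icc (0 : ℝ) 1, vavg (fun x v => h x v - k x v) x = vavg g x :=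
      fun x hx => by
    have h1 : ∫ v in (-1 : ℝ)..1, g x v = ∫ v in (-1 : ℝ)..1, h x v :=
      intervalIntegral.integral_congr fun v hv => hh_eq x hx v (huIcc ▸ hv)
    have h2 : ∫ v in (-1 : ℝ)..1, gs x v = ∫ v in (-1 : ℝ)..1, k x v :=
      intervalIntegral.integral_congr fun v hv => hgs_eq x hx v (huIcc ▸ hv)
    have h3 := havg x hx
    simp only [vavg] at h3 ⊢
    rw [intervalIntegral.integral_sub (Continuous.intervalIntegrable (by fun_prop) _ _)
      (Continuous.intervalIntegrable (by fun_prop) _ _), ← h1, ← h2]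
    linarith
  have e₁ : ∫ x in (0 : ℝ)..1, (((1 / 2) * ∫ v in (-1 : ℝ)..1, v * deriv (fun y => g y v) x)
        + σa x * ρ x - G x) ^ 2
      = ∫ x in (0 : ℝ)..1, ((1 / 2) * (∫ v in (-1 : ℝ)..1, v * (h' x v - k' x v))
        + a x * (r x - rs x)) ^ 2 :=
    intervalIntegral.integral_congr_Ioo_of_le zero_le_one fun x hx => by
      have hxI := Ioo_subset_Icc_self hx
      have h1 := hsol₁ x hxI
      rw [hJs x hx, hrs_eq x hxI, ha_eq x hxI] at h1
      rw [hJ x hx, hJsub, hr_eq x hxI, ha_eq x hxI]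
      congr 1
      linear_combination h1
  have e₂ : ∫ x in (0 : ℝ)..1, vavg g x ^ 2
      = ∫ x in (0 : ℝ)..1, vavg (fun x v => h x v - k x v) x ^ 2 :=
    intervalIntegral.integral_congr_Ioo_of_le zero_le_one fun x hx => by
      simp only [hvavg x (Ioo_subset_Icc_self hx)]
  have e₃ : ∫ x in (0 : ℝ)..1, ∫ v in (-1 : ℝ)..1,
        (v * deriv (fun y => ρ y + ε * g y v) x
          - ε * ((1 / 2) * ∫ w in (-1 : ℝ)..1, w * deriv (fun y => g y w) x)
          - σs x * (vavg g x - g x v) + ε ^ 2 * σa x * g x v) ^ 2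
      = ∫ x in (0 : ℝ)..1, ∫ v in (-1 : ℝ)..1,
        (v * ((r' x - rs' x) + ε * (h' x v - k' x v))
          - ε * ((1 / 2) * ∫ w in (-1 : ℝ)..1, w * (h' x w - k' x w))
          - s x * (vavg (fun x v => h x v - k x v) x - (h x v - k x v))
          + ε ^ 2 * a x * (h x v - k x v)) ^ 2 :=
    intervalIntegral.integral_congr_Ioo_of_le zero_le_one fun x hx =>
      intervalIntegral.integral_congr fun v hv => by
        rw [huIcc] at hv
        have hxI := Ioo_subset_Icc_self hx
        have h1 := hsol₂ x hxI v hv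
        have hds : deriv (fun y => ρs y + ε * gs y v) x = rs' x + ε * k' x v :=
          ((hρsd x hx).add ((hgsd v hv x hx).const_mul ε)).deriv
        have hd : deriv (fun y => ρ y + ε * g y v) x = r' x + ε * h' x v :=
          ((hρd x hx).add ((hgd v hv x hx).const_mul ε)).deriv
        rw [hds, hJs x hx, havg x hxI,
          hgs_eq x hxI v hv, ha_eq x hxI, hs_eq x hxI] at h1
        rw [hd, hJ x hx, hJsub,
          hvavg x hxI, hh_eq x hxI v hv, ha_eq x hxI, hs_eq x hxI]
        congr 1
        linear_combination h1
  have h0I : (0 : ℝ) ∈ Icc (0 : ℝ) 1 := ⟨le_rfl, zero_le_one⟩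
  have h1I : (1 : ℝ) ∈ Icc (0 : ℝ) 1 := ⟨zero_le_one, le_rfl⟩
  have e₄ : ∫ v in (0 : ℝ)..1, (ρ 0 + ε * g 0 v - φ 0 v) ^ 2
      = ∫ v in (0 : ℝ)..1, ((r 0 - rs 0) + ε * (h 0 v - k 0 v)) ^ 2 :=
    intervalIntegral.integral_congr_Ioo_of_le zero_le_one fun v hv => by
      have hvI : v ∈ Icc (-1 : ℝ) 1 := ⟨by linarith [hv.1], hv.2.le⟩
      rw [← hsol₃ v ⟨hv.1, hv.2.le⟩, hr_eq 0 h0I, hrs_eq 0 h0I, hh_eq 0 h0I v hvI,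
        hgs_eq 0 h0I v hvI]
      ring
  have e₅ : ∫ v in (-1 : ℝ)..0, (ρ 1 + ε * g 1 v - φ 1 v) ^ 2
      = ∫ v in (-1 : ℝ)..0, ((r 1 - rs 1) + ε * (h 1 v - k 1 v)) ^ 2 :=
    intervalIntegral.integral_congr_Ioo_of_le (by norm_num) fun v hv => by
      have hvI : v ∈ Icc (-1 : ℝ) 1 := ⟨hv.1.le, by linarith [hv.2]⟩
      rw [← hsol₄ v ⟨hv.1.le, hv.2⟩, hr_eq 1 h1I, hrs_eq 1 h1I, hh_eq 1 h1I v hvI,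
        hgs_eq 1 h1I v hvI]
      ring
  have err_eq : ∫ x in (0 : ℝ)..1, ∫ v in (-1 : ℝ)..1,
        ((ρ x + ε * g x v) - (ρs x + ε * gs x v)) ^ 2
      = ∫ x in (0 : ℝ)..1, ∫ v in (-1 : ℝ)..1,
        ((r x - rs x) + ε * (h x v - k x v)) ^ 2 :=
    intervalIntegral.integral_congr_Ioo_of_le zero_le_one fun x hx =>
      intervalIntegral.integral_congr fun v hv => by
        rw [huIcc] at hv
        have hxI := Ioo_subset_Icc_self hx
        rw [hr_eq x hxI, hrs_eq x hxI, hh_eq x hxI v hv, hgs_eq x hxI v hv]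
        ring
  rw [err_eq, Eloss, e₁, e₂, e₃, e₄, e₅, div_mul_eq_mul_div, le_div_iff₀ hε.1, mul_comm,
    add_assoc (_ + _ + _)]
  exact hmain
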